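/- arXiv:2410.21808 — 2 statements merged into one kernel-verified Lean document; each statement's English description precedes it below -/
import Mathlib

section
/- Let c be a partial proper 4-coloring of a finite simple graph G and fix a color i ∈ {1,2,3,4}. If I is a maximal independent set of the subgraph of G induced on U_i, then C_i ∪ I is a maximal independent set (equivalently, an independent dominating set) of G. -/
/-- `S` is an independent set of `G`: no two of its vertices are adjacent. -/
def IsIndSet {V : Type*} (G : SimpleGraph V) (S : Set V) : Prop :=
  ∀ u ∈ S, ∀ v ∈ S, ¬ G.Adj u v

/-- `S` is a dominating set of `G`. -/
def IsDomSet {V : Type*} (G : SimpleGraph V) (S : Set V) : Prop :=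
  ∀ v, v ∈ S ∨ ∃ u ∈ S, G.Adj u v

/-- `S` is a maximal independent set of `G`. -/
def IsMaxIndSet {V : Type*} (G : SimpleGraph V) (S : Set V) : Prop :=
  IsIndSet G S ∧ ∀ T, IsIndSet G T → S ⊆ T → S = T

/-- `c` is a partial proper 4-coloring of `G`: adjacent vertices never receive
the same color (uncolored vertices are mapped to `none`). -/
def IsPartialProper4Coloring {V : Type*} (G : SimpleGraph V)
    (c : V → Option (Fin 4)) : Prop :=
  ∀ u v, G.Adj u v → ∀ i : Fin 4, c u = some i → c v ≠ some i

/-- `C_i`: the set of vertices colored `i`. -/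
def colorClass {V : Type*} (c : V → Option (Fin 4)) (i : Fin 4) : Set V :=
  {v | c v = some i}

/-- `U_i`: the set of vertices `v` such that no vertex of the closed
neighborhood `N[v]` receives color `i`. -/
def missingSet {V : Type*} (G : SimpleGraph V) (c : V → Option (Fin 4))
    (i : Fin 4) : Set V :=
  {v | ∀ u, (u = v ∨ G.Adj v u) → c u ≠ some i}

/-- `c[v]`: the set of colors appearing on the closed neighborhood `N[v]`. -/
def nbhdColors {V : Type*} (G : SimpleGraph V) (c : V → Option (Fin 4))
    (v : V) : Set (Fin 4) :=
  {i | ∃ u, (u = v ∨ G.Adj v u) ∧ c u = some i}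

/-- `uv` is a bad edge: it is an edge of `G` with one endpoint in `U_i`
and the other in `U_j` for some `i ≠ j`. -/
def BadEdge {V : Type*} (G : SimpleGraph V) (c : V → Option (Fin 4))
    (u v : V) : Prop :=
  G.Adj u v ∧ ∃ i j : Fin 4, i ≠ j ∧ u ∈ missingSet G c i ∧ v ∈ missingSet G c j

/-- If `c` is a partial proper 4-coloring of `G`, `i` is a color,
and `I` is a maximal independent set of the subgraph of `G` induced on `U_i`,
then `C_i ∪ I` is a maximal independent set (equivalently, an independent
dominating set) of `G`. -/
theorem colorClass_union_maxIndep {V : Type*} [Fintype V] (G : SimpleGraph V)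
    (c : V → Option (Fin 4)) (hc : IsPartialProper4Coloring G c) (i : Fin 4)
    (I : Set V) (hIsub : I ⊆ missingSet G c i) (hIind : IsIndSet G I)
    (hImax : ∀ T, T ⊆ missingSet G c i → IsIndSet G T → I ⊆ T → I = T) :
    IsMaxIndSet G (colorClass c i ∪ I) := by
  refine ⟨?_, fun T hT hST => hST.antisymm fun v hv => ?_⟩
  · rintro u (hu | hu) v (hv | hv) huv
    · exact hc u v huv i hu hv
    · exact hIsub hv u (Or.inr huv.symm) hu
    · exact hIsub hu v (Or.inr huv) hv
    · exact hIind u hu v hv huv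
  · by_cases hvi : c v = some i
    · exact Or.inl hvi
    · have hvU : v ∈ missingSet G c i := by
        rintro u (rfl | hvu) hu
        · exact hvi hu
        · exact hT v hv u (hST (Or.inl hu)) hvu
      have hI : I = T ∩ missingSet G c i :=
        hImax _ Set.inter_subset_right (fun u hu w hw => hT u hu.1 w hw.1)
          fun u hu => ⟨hST (Or.inr hu), hIsub hu⟩
      exact Or.inr (hI ▸ ⟨hv, hvU⟩)
end

section
/- Let c be a partial proper 4-coloring of a finite simple graph G such that |c[v]| ≥ 3 for every vertex v and |c[v]| = 4 for every uncolored vertex v. Let uv be a bad edge, let a be the color of u, let c' be the unique color missing from the closed neighborhood of u, and let {b,d} = {1,2,3,4} \ {a,c'}. Then either v is colored b and missing color d, or v is colored d and missing color b (that is, v ∈ (C_b ∩ U_d) ∪ (C_d ∩ U_b)). -/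
theorem not_mem_nbhdColors_of_mem_missingSet {V : Type*} {G : SimpleGraph V}
    {c : V → Option (Fin 4)} {v : V} {i : Fin 4} (h : v ∈ missingSet G c i) :
    i ∉ nbhdColors G c v :=
  fun ⟨w, hw, hwi⟩ => h w hw hwi

/-- A vertex seeing at least three of the four colors misses at most one. -/
theorem eq_of_mem_missingSet {V : Type*} {G : SimpleGraph V}
    {c : V → Option (Fin 4)} {v : V} {i j : Fin 4} (h3 : 3 ≤ (nbhdColors G c v).ncard)
    (hi : v ∈ missingSet G c i) (hj : v ∈ missingSet G c j) : i = j := by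
  by_contra hij
  have hsub : ({i, j} : Set (Fin 4)) ⊆ (nbhdColors G c v)ᶜ := by
    rintro x (rfl | rfl)
    exacts [not_mem_nbhdColors_of_mem_missingSet hi, not_mem_nbhdColors_of_mem_missingSet hj]
  have hle := Set.ncard_le_ncard hsub (Set.toFinite _)
  have hadd := Set.ncard_add_ncard_compl (nbhdColors G c v)
  rw [Set.ncard_pair hij] at hle
  rw [Nat.card_eq_fintype_card, Fintype.card_fin] at hadd
  omega

/-- A vertex missing a color sees fewer than four colors. -/
theorem ncard_nbhdColors_ne_four {V : Type*} {G : SimpleGraph V}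
    {c : V → Option (Fin 4)} {v : V} {i : Fin 4} (hi : v ∈ missingSet G c i) :
    (nbhdColors G c v).ncard ≠ 4 := by
  intro h
  have huniv : nbhdColors G c v = Set.univ :=
    (Set.eq_univ_iff_ncard _).mpr (by simpa using h)
  exact not_mem_nbhdColors_of_mem_missingSet hi (huniv ▸ Set.mem_univ i)

/-- Let `c` be a partial proper 4-coloring of `G` with `|c[v]| ≥ 3`
for all `v` and `|c[v]| = 4` for all uncolored `v`. Let `uv` be a bad edge, `a`
the color of `u`, `c'` the (unique) color missing from `N[u]`, and
`{b,d} = {1,2,3,4} \ {a,c'}`. Then `v ∈ (C_b ∩ U_d) ∪ (C_d ∩ U_b)`. -/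
theorem badEdge_other_endpoint {V : Type*} [Fintype V]
    (G : SimpleGraph V) (c : V → Option (Fin 4))
    (hc : IsPartialProper4Coloring G c)
    (h3 : ∀ v, 3 ≤ (nbhdColors G c v).ncard)
    (h4 : ∀ v, c v = none → (nbhdColors G c v).ncard = 4)
    (u v : V) (hbad : BadEdge G c u v)
    (a c' b d : Fin 4)
    (ha : c u = some a)
    (hc' : u ∈ missingSet G c c')
    (hbd : ({b, d} : Set (Fin 4)) = ({a, c'} : Set (Fin 4))ᶜ) :
    v ∈ (colorClass c b ∩ missingSet G c d) ∪ (colorClass c d ∩ missingSet G c b) := by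
  obtain ⟨hadj, i, j, hij, hi, hj⟩ := hbad
  have hic : i = c' := eq_of_mem_missingSet (h3 u) hi hc'
  have hmem : ∀ x, x ≠ a → x ≠ c' → x = b ∨ x = d := by
    intro x hxa hxc
    have hx : x ∈ ({a, c'} : Set (Fin 4))ᶜ := by simp [hxa, hxc]
    rw [← hbd] at hx
    simpa using hx
  obtain ⟨e, he⟩ : ∃ e, c v = some e :=
    Option.ne_none_iff_exists'.mp fun h => ncard_nbhdColors_ne_four hj (h4 v h)
  have hea : e ≠ a := by
    rintro rfl
    exact hc u v hadj e ha he
  have hec : e ≠ c' := by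
    rintro rfl
    exact hc' v (Or.inr hadj) he
  have hja : j ≠ a := by
    rintro rfl
    exact hj u (Or.inr hadj.symm) ha
  have hjc : j ≠ c' := fun h => hij (hic.trans h.symm)
  have hje : j ≠ e := by
    rintro rfl
    exact hj v (Or.inl rfl) he
  rcases hmem e hea hec with rfl | rfl <;> rcases hmem j hja hjc with rfl | rfl
  · exact absurd rfl hje
  · exact Or.inl ⟨he, hj⟩
  · exact Or.inr ⟨he, hj⟩
  · exact absurd rfl hje
end
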